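/- If γ* ≤ 1/δ, then the constant function G ≡ x/δ on (0,1) is a feasible quantile function whose objective value equals x/δ, and its objective value is greater than or equal to the objective value of every feasible quantile function; i.e., it is optimal. -/

import Mathlib

open MeasureTheory Set Filter Topology ENNReal

noncomputable section

/-- The CDF of a random variable `ρ` under the measure `μ`. -/
def cdfFun {Ω : Type*} [MeasurableSpace Ω] (μ : Measure Ω) (ρ : Ω → ℝ) : ℝ → ℝ :=
  fun t => (μ {ω | ρ ω ≤ t}).toReal

/-- The right-continuous quantile function of `ρ`:
`F_ρ⁻¹(z) = inf {t : F_ρ(t) > z}`. -/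
def rcInv {Ω : Type*} [MeasurableSpace Ω] (μ : Measure Ω) (ρ : Ω → ℝ) : ℝ → ℝ :=
  fun z => sInf {t : ℝ | z < cdfFun μ ρ t}

/-- A feasible quantile function for pricing-density `F = F_ρ⁻¹` and initial wealth `x`:
nondecreasing and right-continuous on `(0,1)`, with `lim_{z↓0} G(z) ≥ 0`, satisfying the
budget constraint `∫_0^1 F(1-z) G(z) dz ≤ x`. -/
def Feasible (F : ℝ → ℝ) (x : ℝ) (G : ℝ → ℝ) : Prop :=
  MonotoneOn G (Set.Ioo 0 1)
  ∧ (∀ z ∈ Set.Ioo (0:ℝ) 1, Filter.Tendsto G (nhdsWithin z (Set.Ioi z)) (nhds (G z)))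
  ∧ (∃ L, 0 ≤ L ∧ Filter.Tendsto G (nhdsWithin 0 (Set.Ioi 0)) (nhds L))
  ∧ ∫⁻ z in Set.Ioo (0:ℝ) 1, ENNReal.ofReal (F (1 - z) * G z) ≤ ENNReal.ofReal x

/-- The extension `Ḡ` of a (nonnegative) quantile function `G` from `(0,1)` to `[0,1]`,
valued in `[0,∞]`, with `Ḡ(0) = lim_{z↓0} G(z)` and `Ḡ(1) = lim_{z↑1} G(z)`
(these limits are the inf/sup over `(0,1)` since `G` is nondecreasing). -/
def Gbar (G : ℝ → ℝ) : ℝ → ℝ≥0∞ := fun z =>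
  if z = 0 then ⨅ y ∈ Set.Ioo (0:ℝ) 1, ENNReal.ofReal (G y)
  else if z = 1 then ⨆ y ∈ Set.Ioo (0:ℝ) 1, ENNReal.ofReal (G y)
  else ENNReal.ofReal (G z)

/-- The objective value `∫_{[0,1]} Ḡ(z) m(dz)` of a quantile function `G`
(for `m` a Borel probability measure carried by `[0,1]`). -/
def objVal (m : Measure ℝ) (G : ℝ → ℝ) : ℝ≥0∞ := ∫⁻ z, Gbar G z ∂m

/-- `ζ(c) = m([c,1]) / ∫_c^1 F(1-z) dz`. -/
def zeta (F : ℝ → ℝ) (m : Measure ℝ) (c : ℝ) : ℝ :=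
  (m (Set.Icc c 1)).toReal / ∫ z in c..1, F (1 - z)

/-- Stochastic dominance extends from closed half-lines to all upper sets. -/
lemma measure_le_of_isUpperSet {m ν : Measure ℝ} [IsFiniteMeasure m]
    (h : ∀ c, m (Ici c) ≤ ν (Ici c)) {S : Set ℝ} (hS : IsUpperSet S) : m S ≤ ν S := by
  rw [hS.ordConnected.measurableSet.measure_eq_iSup_isCompact m]
  refine iSup_le fun K => iSup_le fun hKS => iSup_le fun hK => ?_
  rcases K.eq_empty_or_nonempty with rfl | hne
  · simp
  · have hmin := hKS (hK.sInf_mem hne)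
    calc m K ≤ m (Ici (sInf K)) := measure_mono fun y hy => csInf_le hK.bddBelow hy
      _ ≤ ν (Ici (sInf K)) := h _
      _ ≤ ν S := measure_mono fun y hy => hS hy hmin

lemma lintegral_ofReal_le_of_monotone {m ν : Measure ℝ} [IsFiniteMeasure m]
    (h : ∀ c, m (Ici c) ≤ ν (Ici c)) {g : ℝ → ℝ} (hg : Monotone g) (hg0 : 0 ≤ g) :
    ∫⁻ z, ENNReal.ofReal (g z) ∂m ≤ ∫⁻ z, ENNReal.ofReal (g z) ∂ν := by
  rw [lintegral_eq_lintegral_meas_lt m (.of_forall hg0) hg.measurable.aemeasurable,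
    lintegral_eq_lintegral_meas_lt ν (.of_forall hg0) hg.measurable.aemeasurable]
  exact lintegral_mono fun t =>
    measure_le_of_isUpperSet h fun a b hab ha => lt_of_lt_of_le ha (hg hab)

/-- Integrals of monotone functions are monotone for stochastic dominance. -/
lemma lintegral_le_of_monotone {m ν : Measure ℝ} [IsFiniteMeasure m]
    (h : ∀ c, m (Ici c) ≤ ν (Ici c)) {g : ℝ → ℝ≥0∞} (hg : Monotone g) :
    ∫⁻ z, g z ∂m ≤ ∫⁻ z, g z ∂ν := by
  have hsup : ∀ z, g z = ⨆ n : ℕ, min (g z) n := fun z => by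
    rw [← inf_iSup_eq, ENNReal.iSup_natCast, inf_top_eq]
  have hmeas : ∀ n : ℕ, Measurable fun z => min (g z) n := fun n =>
    hg.measurable.min measurable_const
  have hmono : Monotone fun (n : ℕ) z => min (g z) (n : ℝ≥0∞) := fun a b hab z =>
    min_le_min_left _ (by exact_mod_cast hab)
  have hfin : ∀ (n : ℕ) z, min (g z) (n : ℝ≥0∞) ≠ ∞ := fun n z =>
    ne_top_of_le_ne_top (ENNReal.natCast_ne_top n) (min_le_right _ _)
  rw [lintegral_congr hsup, lintegral_congr hsup, lintegral_iSup hmeas hmono, lintegral_iSup hmeas hmono]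
  refine iSup_mono fun n => ?_
  have := lintegral_ofReal_le_of_monotone h (g := fun z => (min (g z) (n : ℝ≥0∞)).toReal)
    (fun a b hab => ENNReal.toReal_mono (hfin n b) (min_le_min_right _ (hg hab)))
    (fun z => ENNReal.toReal_nonneg)
  simpa only [ENNReal.ofReal_toReal (hfin n _)] using this

/-- The monotone extension to `ℝ` of the restriction of `Gbar G` to `[0,1]`. -/
def GbarExt (G : ℝ → ℝ) : ℝ → ℝ≥0∞ := fun z =>
  if z ≤ 0 then ⨅ y ∈ Set.Ioo (0:ℝ) 1, ENNReal.ofReal (G y)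
  else if 1 ≤ z then ⨆ y ∈ Set.Ioo (0:ℝ) 1, ENNReal.ofReal (G y)
  else ENNReal.ofReal (G z)

lemma gbarExt_eq_Gbar (G : ℝ → ℝ) {z : ℝ} (hz : z ∈ Icc (0:ℝ) 1) : GbarExt G z = Gbar G z := by
  have h0 : z ≤ 0 ↔ z = 0 := ⟨fun h => le_antisymm h hz.1, fun h => h.le⟩
  have h1 : 1 ≤ z ↔ z = 1 := ⟨fun h => le_antisymm hz.2 h, fun h => h.ge⟩
  simp only [GbarExt, Gbar, h0, h1]

lemma gbarExt_of_mem_Ioo (G : ℝ → ℝ) {z : ℝ} (hz : z ∈ Ioo (0:ℝ) 1) :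
    GbarExt G z = ENNReal.ofReal (G z) := by
  simp [GbarExt, not_le.2 hz.1, not_le.2 hz.2]

lemma monotone_gbarExt {G : ℝ → ℝ} (hG : MonotoneOn G (Ioo 0 1)) : Monotone (GbarExt G) := by
  intro a b hab
  have half : (1 / 2 : ℝ) ∈ Ioo (0:ℝ) 1 := by norm_num
  have hinf : ∀ y ∈ Ioo (0:ℝ) 1,
      ⨅ y ∈ Set.Ioo (0:ℝ) 1, ENNReal.ofReal (G y) ≤ ENNReal.ofReal (G y) :=
    fun y hy => iInf₂_le y hy
  have hsup : ∀ y ∈ Ioo (0:ℝ) 1,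
      ENNReal.ofReal (G y) ≤ ⨆ y ∈ Set.Ioo (0:ℝ) 1, ENNReal.ofReal (G y) :=
    fun y hy => le_iSup₂ (f := fun y (_ : y ∈ Set.Ioo (0:ℝ) 1) => ENNReal.ofReal (G y)) y hy
  unfold GbarExt
  split_ifs with ha hb hb1 ha1 hb hb1 hb hb1
  · exact le_rfl
  · exact (hinf _ half).trans (hsup _ half)
  · exact hinf b ⟨not_le.1 hb, not_le.1 hb1⟩
  all_goals first
    | exact absurd (hab.trans ‹b ≤ 0›) ha
    | exact le_rfl
    | exact absurd (‹1 ≤ a›.trans hab) ‹¬ 1 ≤ b›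
    | exact hsup a ⟨not_le.1 ha, not_le.1 ‹¬ 1 ≤ a›⟩
    | exact ENNReal.ofReal_le_ofReal (hG ⟨not_le.1 ha, not_le.1 ‹¬ 1 ≤ a›⟩
        ⟨not_le.1 ‹¬ b ≤ 0›, not_le.1 ‹¬ 1 ≤ b›⟩ hab)

lemma objVal_const (m : Measure ℝ) [IsProbabilityMeasure m] (a : ℝ) :
    objVal m (fun _ => a) = ENNReal.ofReal a := by
  have hne : (Ioo (0:ℝ) 1).Nonempty := ⟨1 / 2, by norm_num⟩
  have : Gbar (fun _ => a) = fun _ => ENNReal.ofReal a := by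
    funext z
    simp only [Gbar, biInf_const hne, biSup_const hne, ite_self]
  simp [objVal, this]

lemma rcInv_pos {Ω : Type*} [MeasurableSpace Ω] {μ : Measure Ω} [IsProbabilityMeasure μ]
    {ρ : Ω → ℝ} (hρmeas : Measurable ρ) (hρpos : ∀ ω, 0 < ρ ω)
    (hcdf : Continuous (cdfFun μ ρ)) {z : ℝ} (hz : z ∈ Ioo (0:ℝ) 1) : 0 < rcInv μ ρ z := by
  have hle0 : ∀ t ≤ 0, cdfFun μ ρ t = 0 := fun t ht => by
    have : {ω | ρ ω ≤ t} = ∅ :=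
      eq_empty_of_forall_notMem fun ω hω => (hρpos ω).not_ge (le_trans hω ht)
    simp [cdfFun, this]
  have hlim : Tendsto (cdfFun μ ρ) atTop (𝓝 1) := by
    have := Measure.isProbabilityMeasure_map (μ := μ) hρmeas.aemeasurable
    refine (ProbabilityTheory.tendsto_cdf_atTop (μ.map ρ)).congr fun t => ?_
    rw [ProbabilityTheory.cdf_eq_real, map_measureReal_apply hρmeas measurableSet_Iic]
    rfl
  obtain ⟨t₀, ht₀⟩ := (hlim.eventually (lt_mem_nhds hz.2)).exists
  obtain ⟨ε, hε, hball⟩ := Metric.eventually_nhds_iff.1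
    (hcdf.continuousAt.eventually_lt_const (by rw [hle0 0 le_rfl]; exact hz.1) :
      ∀ᶠ t in 𝓝 0, cdfFun μ ρ t < z)
  refine hε.trans_le (le_csInf ⟨t₀, ht₀⟩ fun t ht => ?_)
  by_contra! hlt
  rcases le_or_gt t 0 with h | h
  · exact absurd (hle0 t h ▸ ht : z < 0) hz.1.not_gt
  · exact absurd ht (hball (by rwa [Real.dist_eq, sub_zero, abs_of_pos h])).not_gt

/-- If the tail masses of `m` are dominated by the normalised pricing density `f / δ`, then a
monotone quantile function has objective value at most its cost divided by `δ`. -/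
lemma objVal_le_of_tail_le {m : Measure ℝ} [IsProbabilityMeasure m]
    (hm : m (Icc (0:ℝ) 1)ᶜ = 0) {f : ℝ → ℝ} (hf : ∀ z ∈ Ioo (0:ℝ) 1, 0 < f z)
    (hfi : IntervalIntegrable f volume 0 1) {δ : ℝ} (hδ : 0 < δ) (hδf : δ = ∫ z in (0:ℝ)..1, f z)
    (htail : ∀ c ∈ Ioo (0:ℝ) 1, m (Ici c) ≤ ENNReal.ofReal ((∫ z in c..1, f z) / δ))
    {G : ℝ → ℝ} (hG : MonotoneOn G (Ioo 0 1)) :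
    objVal m G ≤ (∫⁻ z in Ioo (0:ℝ) 1, ENNReal.ofReal (f z * G z)) / ENNReal.ofReal δ := by
  have hfIoo : IntegrableOn f (Ioo 0 1) := (intervalIntegrable_iff_integrableOn_Ioo_of_le
    zero_le_one).1 hfi
  have hdens : AEMeasurable (fun z => ENNReal.ofReal (f z / δ)) (volume.restrict (Ioo 0 1)) :=
    (hfIoo.aestronglyMeasurable.aemeasurable.div_const δ).ennreal_ofReal
  set ν := (volume.restrict (Ioo (0:ℝ) 1)).withDensity fun z => ENNReal.ofReal (f z / δ) with hν
  have hνIci : ∀ c ∈ Icc (0:ℝ) 1, ν (Ici c) = ENNReal.ofReal ((∫ z in c..1, f z) / δ) := by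
    intro c hc
    have hsub : Ioo c 1 ⊆ Ioo 0 1 := Ioo_subset_Ioo_left hc.1
    have hset : (Ici c ∩ Ioo (0:ℝ) 1 : Set ℝ) =ᵐ[volume] Ioo c 1 := by
      refine (ae_eq_set_inter Ioi_ae_eq_Ici.symm (ae_eq_refl _)).trans (.of_eq ?_)
      ext z
      exact ⟨fun h => ⟨h.1, h.2.2⟩, fun h => ⟨h.1, hsub h⟩⟩
    rw [hν, withDensity_apply _ measurableSet_Ici, Measure.restrict_restrict measurableSet_Ici,
      Measure.restrict_congr_set hset, ← intervalIntegral.integral_div,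
      intervalIntegral.integral_of_le hc.2, integral_Ioc_eq_integral_Ioo,
      ofReal_integral_eq_lintegral_ofReal ((hfIoo.mono_set hsub).div_const δ)]
    filter_upwards [ae_restrict_mem measurableSet_Ioo] with z hz
    exact (div_pos (hf z (hsub hz)) hδ).le
  have hdom : ∀ c, m (Ici c) ≤ ν (Ici c) := by
    intro c
    rcases le_or_gt c 0 with hc0 | hc0
    · calc m (Ici c) ≤ 1 := prob_le_one
        _ = ν (Ici 0) := by rw [hνIci 0 (by simp), ← hδf, div_self hδ.ne', ENNReal.ofReal_one]
        _ ≤ ν (Ici c) := measure_mono (Ici_subset_Ici.2 hc0)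
    rcases lt_or_ge c 1 with hc1 | hc1
    · exact (htail c ⟨hc0, hc1⟩).trans (hνIci c ⟨hc0.le, hc1.le⟩).ge
    · have hcont : ContinuousWithinAt (fun c => ∫ z in c..1, f z) (Ioo 0 1) 1 := by
        refine ((intervalIntegral.continuousOn_primitive_interval_left (a := 0) (b := 1) ?_) 1
          (by simp)).mono (by rw [uIcc_of_le zero_le_one]; exact Ioo_subset_Icc_self)
        rw [uIcc_of_le zero_le_one]
        exact (intervalIntegrable_iff_integrableOn_Icc_of_le zero_le_one).1 hfi
      have hlim : Tendsto (fun c => ENNReal.ofReal ((∫ z in c..1, f z) / δ))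
          (𝓝[Ioo 0 1] 1) (𝓝 0) := by
        have := ENNReal.tendsto_ofReal (hcont.tendsto.div_const δ)
        simpa using this
      have : (𝓝[Ioo (0:ℝ) 1] 1).NeBot := right_nhdsWithin_Ioo_neBot zero_lt_one
      refine (ge_of_tendsto hlim ?_).trans zero_le
      filter_upwards [self_mem_nhdsWithin] with b hb
      exact (measure_mono (Ici_subset_Ici.2 (hb.2.le.trans hc1))).trans (htail b hb)
  calc objVal m G = ∫⁻ z, GbarExt G z ∂m := by
        refine lintegral_congr_ae ?_
        filter_upwards [measure_eq_zero_iff_ae_notMem.1 hm] with z hz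
        exact (gbarExt_eq_Gbar G (not_not.1 hz)).symm
    _ ≤ ∫⁻ z, GbarExt G z ∂ν := lintegral_le_of_monotone hdom (monotone_gbarExt hG)
    _ = ∫⁻ z in Ioo (0:ℝ) 1, ENNReal.ofReal (f z * G z) / ENNReal.ofReal δ := by
        rw [hν, lintegral_withDensity_eq_lintegral_mul₀ hdens
          (monotone_gbarExt hG).measurable.aemeasurable]
        refine setLIntegral_congr_fun measurableSet_Ioo fun z hz => ?_
        rw [Pi.mul_apply, gbarExt_of_mem_Ioo G hz, ENNReal.ofReal_div_of_pos hδ,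
          ENNReal.ofReal_mul (hf z hz).le, ENNReal.mul_div_right_comm]
    _ = _ := by
        simp_rw [div_eq_mul_inv]
        exact lintegral_mul_const' _ _ (by simpa using hδ)

/-- if `γ* ≤ 1/δ`, the constant function `G ≡ x/δ` is feasible, its
objective value equals `x/δ`, and it is optimal among feasible quantile functions. -/
theorem constant_optimal_of_gammaStar_le
    {Ω : Type*} [MeasurableSpace Ω] (μ : Measure Ω) [IsProbabilityMeasure μ]
    (ρ : Ω → ℝ) (hρmeas : Measurable ρ) (hρpos : ∀ ω, 0 < ρ ω)
    (hρint : Integrable ρ μ) (hcdf : Continuous (cdfFun μ ρ))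
    (m : Measure ℝ) [IsProbabilityMeasure m] (hm : m (Set.Icc (0:ℝ) 1)ᶜ = 0)
    (x δ : ℝ) (hx : 0 < x) (hδpos : 0 < δ)
    (hδ1 : δ = ∫ ω, ρ ω ∂μ) (hδ2 : δ = ∫ z in (0:ℝ)..1, rcInv μ ρ (1 - z))
    (hγ : (⨆ c ∈ Set.Ioo (0:ℝ) 1, ENNReal.ofReal (zeta (rcInv μ ρ) m c))
            ≤ ENNReal.ofReal (1 / δ)) :
    Feasible (rcInv μ ρ) x (fun _ => x / δ)
    ∧ objVal m (fun _ => x / δ) = ENNReal.ofReal (x / δ)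
    ∧ ∀ G : ℝ → ℝ, Feasible (rcInv μ ρ) x G →
        objVal m G ≤ objVal m (fun _ => x / δ) := by
  set f : ℝ → ℝ := fun z => rcInv μ ρ (1 - z)
  have hf : ∀ z ∈ Ioo (0:ℝ) 1, 0 < f z := fun z hz =>
    rcInv_pos hρmeas hρpos hcdf ⟨by linarith [hz.2], by linarith [hz.1]⟩
  have hfi : IntervalIntegrable f volume 0 1 :=
    intervalIntegral.intervalIntegrable_of_integral_ne_zero (hδ2 ▸ hδpos.ne')
  have hf_lintegral : ∫⁻ z in Ioo (0:ℝ) 1, ENNReal.ofReal (f z) = ENNReal.ofReal δ := by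
    rw [hδ2, intervalIntegral.integral_of_le zero_le_one, integral_Ioc_eq_integral_Ioo,
      ofReal_integral_eq_lintegral_ofReal
        ((intervalIntegrable_iff_integrableOn_Ioo_of_le zero_le_one).1 hfi)]
    filter_upwards [ae_restrict_mem measurableSet_Ioo] with z hz using (hf z hz).le
  have htail : ∀ c ∈ Ioo (0:ℝ) 1, m (Ici c) ≤ ENNReal.ofReal ((∫ z in c..1, f z) / δ) := by
    intro c hc
    have hI : 0 < ∫ z in c..1, f z := by
      refine intervalIntegral.intervalIntegral_pos_of_pos_on (hfi.mono_set ?_)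
        (fun z hz => hf z ⟨hc.1.trans hz.1, hz.2⟩) hc.2
      rw [uIcc_of_le hc.2.le, uIcc_of_le zero_le_one]
      exact Icc_subset_Icc_left hc.1.le
    have hζ : (m (Icc c 1)).toReal / (∫ z in c..1, f z) ≤ 1 / δ :=
      (ENNReal.ofReal_le_ofReal_iff (by positivity)).1
        ((le_iSup₂ (f := fun c (_ : c ∈ Ioo (0:ℝ) 1) =>
          ENNReal.ofReal (zeta (rcInv μ ρ) m c)) c hc).trans hγ)
    have hIci : m (Ici c) ≤ m (Icc c 1) := by
      calc m (Ici c) ≤ m (Icc c 1 ∪ (Icc 0 1)ᶜ) := measure_mono fun z (hz : c ≤ z) => by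
            by_cases h : z ≤ 1
            · exact Or.inl ⟨hz, h⟩
            · exact Or.inr fun h' => h h'.2
        _ ≤ m (Icc c 1) + m (Icc 0 1)ᶜ := measure_union_le _ _
        _ = m (Icc c 1) := by rw [hm, add_zero]
    refine hIci.trans ((ENNReal.le_ofReal_iff_toReal_le (measure_ne_top _ _) (by positivity)).2 ?_)
    rw [div_le_iff₀ hI] at hζ
    exact hζ.trans_eq (by ring)
  refine ⟨⟨monotoneOn_const, fun z _ => tendsto_const_nhds,
    ⟨x / δ, by positivity, tendsto_const_nhds⟩, ?_⟩, objVal_const m _, fun G hG => ?_⟩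
  · simp_rw [ENNReal.ofReal_mul' (show 0 ≤ x / δ by positivity)]
    rw [lintegral_mul_const' _ _ ENNReal.ofReal_ne_top, hf_lintegral,
      ← ENNReal.ofReal_mul hδpos.le, mul_div_cancel₀ _ hδpos.ne']
  · rw [objVal_const, ENNReal.ofReal_div_of_pos hδpos]
    exact (objVal_le_of_tail_le hm hf hfi hδpos hδ2 htail hG.1).trans
      (ENNReal.div_le_div_right hG.2.2.2 _)
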